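/- Let a<b, α,β ∈ (0,1), γ ∈ [0,1], N ∈ ℕ, L ∈ C¹([a,b]×ℝ^{2N};ℝ), and y^a, y^b ∈ ℝ^N. Suppose y = (y_1,…,y_N) ∈ D with y(a)=y^a and y(b)=y^b is a local minimizer of J(y) = ∫_a^b L(x, y(x), ^CD^{α,β}_γ y(x)) dx among all functions in D satisfying the same boundary conditions, and assume that for each i = 2,…,N+1 the function x ↦ ∂_{N+i}L(x, y(x), ^CD^{α,β}_γ y(x)) admits continuous Riemann–Liouville derivatives ₐD_x^β and ₓD_b^α on [a,b]. Then y satisfies the system of N fractional Euler–Lagrange equations ∂_iL(x, y(x), ^CD^{α,β}_γ y(x)) + (D^{β,α}_{1−γ} ∂_{N+i}L(·, y(·), ^CD^{α,β}_γ y(·)))(x) = 0, for i = 2,…,N+1 and all x ∈ [a,b]. -/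

import Mathlib

open MeasureTheory Set

noncomputable section

/-- Left Riemann–Liouville fractional integral of order `α` with lower limit `a`. -/
def leftRLI (a α : ℝ) (f : ℝ → ℝ) (x : ℝ) : ℝ :=
  (1 / Real.Gamma α) * ∫ t in a..x, (x - t) ^ (α - 1) * f t

/-- Right Riemann–Liouville fractional integral of order `α` with upper limit `b`. -/
def rightRLI (b α : ℝ) (f : ℝ → ℝ) (x : ℝ) : ℝ :=
  (1 / Real.Gamma α) * ∫ t in x..b, (t - x) ^ (α - 1) * f t

/-- Left Caputo fractional derivative of order `α`. -/
def caputoL (a α : ℝ) (f : ℝ → ℝ) (x : ℝ) : ℝ :=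
  (1 / Real.Gamma (1 - α)) * ∫ t in a..x, (x - t) ^ (-α) * deriv f t

/-- Right Caputo fractional derivative of order `α`. -/
def caputoR (b α : ℝ) (f : ℝ → ℝ) (x : ℝ) : ℝ :=
  (-1 / Real.Gamma (1 - α)) * ∫ t in x..b, (t - x) ^ (-α) * deriv f t

/-- Combined Caputo fractional derivative `^C D^{α,β}_γ`. -/
def combCaputo (a b α β γ : ℝ) (f : ℝ → ℝ) (x : ℝ) : ℝ :=
  γ * caputoL a α f x + (1 - γ) * caputoR b β f x

/-- Left Riemann–Liouville fractional derivative of order `α`. -/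
def leftRLD (a α : ℝ) (g : ℝ → ℝ) (x : ℝ) : ℝ :=
  (1 / Real.Gamma (1 - α)) * deriv (fun s => ∫ t in a..s, (s - t) ^ (-α) * g t) x

/-- Right Riemann–Liouville fractional derivative of order `α`. -/
def rightRLD (b α : ℝ) (g : ℝ → ℝ) (x : ℝ) : ℝ :=
  (-1 / Real.Gamma (1 - α)) * deriv (fun s => ∫ t in s..b, (t - s) ^ (-α) * g t) x

/-- Combined Riemann–Liouville derivative `D^{β,α}_{1-γ} = (1-γ) ₐD_x^β + γ ₓD_b^α`. -/
def combRLD (a b β α γ : ℝ) (g : ℝ → ℝ) (x : ℝ) : ℝ :=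
  (1 - γ) * leftRLD a β g x + γ * rightRLD b α g x

/-- Componentwise combined Caputo derivative of a vector-valued function. -/
def combCaputoVec (a b α β γ : ℝ) {N : ℕ} (y : ℝ → Fin N → ℝ) (x : ℝ) : Fin N → ℝ :=
  fun i => combCaputo a b α β γ (fun t => y t i) x

/-- The class `D`: `y'` and `^C D^{α,β}_γ y` exist and are continuous on `[a,b]`. -/
def MemD (a b α β γ : ℝ) {N : ℕ} (y : ℝ → Fin N → ℝ) : Prop :=
  (∀ x ∈ Icc a b, DifferentiableAt ℝ y x) ∧
  ContinuousOn (deriv y) (Icc a b) ∧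
  ContinuousOn (combCaputoVec a b α β γ y) (Icc a b)

/-- The norm `‖·‖_{1,∞}` on `D`. -/
def norm1inf (a b α β γ : ℝ) {N : ℕ} (y : ℝ → Fin N → ℝ) : ℝ :=
  sSup ((fun x => ‖y x‖) '' Icc a b) + sSup ((fun x => ‖deriv y x‖) '' Icc a b) +
    sSup ((fun x => ‖combCaputoVec a b α β γ y x‖) '' Icc a b)

/-- Partial derivative of `L` with respect to the `i`-th component of its second
(vector) argument, i.e. `∂_{i+2} L` in the paper's numbering (`i : Fin N` ↦ `i+2`). -/
def pY {N : ℕ} (L : ℝ → (Fin N → ℝ) → (Fin N → ℝ) → (Fin N → ℝ) → ℝ)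
    (x : ℝ) (u v w : Fin N → ℝ) (i : Fin N) : ℝ :=
  deriv (fun s => L x (Function.update u i s) v w) (u i)

/-- Partial derivative w.r.t. the `i`-th component of the third argument (`∂_{N+i+2} L`). -/
def pV {N : ℕ} (L : ℝ → (Fin N → ℝ) → (Fin N → ℝ) → (Fin N → ℝ) → ℝ)
    (x : ℝ) (u v w : Fin N → ℝ) (i : Fin N) : ℝ :=
  deriv (fun s => L x u (Function.update v i s) w) (v i)

/-- Partial derivative w.r.t. the `i`-th component of the fourth argument (`∂_{2N+i+2} L`). -/
def pW {N : ℕ} (L : ℝ → (Fin N → ℝ) → (Fin N → ℝ) → (Fin N → ℝ) → ℝ)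
    (x : ℝ) (u v w : Fin N → ℝ) (i : Fin N) : ℝ :=
  deriv (fun s => L x u v (Function.update w i s)) (w i)

/-- `L[y](x) = L(x, y(x), y'(x), ^C D^{α,β}_γ y(x))`. -/
def lagAlong (a b α β γ : ℝ) {N : ℕ} (L : ℝ → (Fin N → ℝ) → (Fin N → ℝ) → (Fin N → ℝ) → ℝ)
    (y : ℝ → Fin N → ℝ) (x : ℝ) : ℝ :=
  L x (y x) (deriv y x) (combCaputoVec a b α β γ y x)

def pYAlong (a b α β γ : ℝ) {N : ℕ} (L : ℝ → (Fin N → ℝ) → (Fin N → ℝ) → (Fin N → ℝ) → ℝ)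
    (y : ℝ → Fin N → ℝ) (i : Fin N) (x : ℝ) : ℝ :=
  pY L x (y x) (deriv y x) (combCaputoVec a b α β γ y x) i

def pVAlong (a b α β γ : ℝ) {N : ℕ} (L : ℝ → (Fin N → ℝ) → (Fin N → ℝ) → (Fin N → ℝ) → ℝ)
    (y : ℝ → Fin N → ℝ) (i : Fin N) (x : ℝ) : ℝ :=
  pV L x (y x) (deriv y x) (combCaputoVec a b α β γ y x) i

def pWAlong (a b α β γ : ℝ) {N : ℕ} (L : ℝ → (Fin N → ℝ) → (Fin N → ℝ) → (Fin N → ℝ) → ℝ)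
    (y : ℝ → Fin N → ℝ) (i : Fin N) (x : ℝ) : ℝ :=
  pW L x (y x) (deriv y x) (combCaputoVec a b α β γ y x) i

/-- `g` is continuously differentiable on `[a,b]`. -/
def ContDiffOn1 (a b : ℝ) (g : ℝ → ℝ) : Prop :=
  (∀ x ∈ Icc a b, DifferentiableAt ℝ g x) ∧ ContinuousOn (deriv g) (Icc a b)

/-- `g` admits a continuous left Riemann–Liouville derivative `ₐD_x^β` on `[a,b]`. -/
def HasContLeftRLD (a b β : ℝ) (g : ℝ → ℝ) : Prop :=
  (∀ x ∈ Icc a b, DifferentiableAt ℝ (fun s => ∫ t in a..s, (s - t) ^ (-β) * g t) x) ∧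
  ContinuousOn (leftRLD a β g) (Icc a b)

/-- `g` admits a continuous right Riemann–Liouville derivative `ₓD_b^α` on `[a,b]`. -/
def HasContRightRLD (a b α : ℝ) (g : ℝ → ℝ) : Prop :=
  (∀ x ∈ Icc a b, DifferentiableAt ℝ (fun s => ∫ t in s..b, (t - s) ^ (-α) * g t) x) ∧
  ContinuousOn (rightRLD b α g) (Icc a b)

/-- The functional `J(y) = ∫_a^b L[y](x) dx`. -/
def Jfun (a b α β γ : ℝ) {N : ℕ} (L : ℝ → (Fin N → ℝ) → (Fin N → ℝ) → (Fin N → ℝ) → ℝ)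
    (y : ℝ → Fin N → ℝ) : ℝ :=
  ∫ x in a..b, lagAlong a b α β γ L y x


/-- `∂_{i+2} L` for a Lagrangian `L(x, y, ^CD^{α,β}_γ y)` without classical derivatives. -/
def pY₂ {N : ℕ} (L : ℝ → (Fin N → ℝ) → (Fin N → ℝ) → ℝ)
    (x : ℝ) (u w : Fin N → ℝ) (i : Fin N) : ℝ :=
  deriv (fun s => L x (Function.update u i s) w) (u i)

/-- `∂_{N+i+2} L` for a Lagrangian `L(x, y, ^CD^{α,β}_γ y)`. -/
def pW₂ {N : ℕ} (L : ℝ → (Fin N → ℝ) → (Fin N → ℝ) → ℝ)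
    (x : ℝ) (u w : Fin N → ℝ) (i : Fin N) : ℝ :=
  deriv (fun s => L x u (Function.update w i s)) (w i)

def pY₂Along (a b α β γ : ℝ) {N : ℕ} (L : ℝ → (Fin N → ℝ) → (Fin N → ℝ) → ℝ)
    (y : ℝ → Fin N → ℝ) (i : Fin N) (x : ℝ) : ℝ :=
  pY₂ L x (y x) (combCaputoVec a b α β γ y x) i

def pW₂Along (a b α β γ : ℝ) {N : ℕ} (L : ℝ → (Fin N → ℝ) → (Fin N → ℝ) → ℝ)
    (y : ℝ → Fin N → ℝ) (i : Fin N) (x : ℝ) : ℝ :=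
  pW₂ L x (y x) (combCaputoVec a b α β γ y x) i

lemma aux_deriv {E : Type*} [NormedAddCommGroup E] [NormedSpace ℝ E] {a b : ℝ} (hab : a < b)
    (P : E → ℝ) (hP : ContDiff ℝ 1 P) (c d : ℝ → E) (hc : ContinuousOn c (Icc a b))
    (hd : ContinuousOn d (Icc a b)) :
    HasDerivAt (fun ε : ℝ => ∫ x in a..b, P (c x + ε • d x))
      (∫ x in a..b, fderiv ℝ P (c x) (d x)) 0 := by
  have hPd : Continuous (fderiv ℝ P) := hP.continuous_fderiv (by norm_num)
  have hU : uIoc a b = Ioc a b := uIoc_of_le hab.le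
  have hcont : ∀ ε : ℝ, ContinuousOn (fun x => P (c x + ε • d x)) (Icc a b) := fun ε =>
    hP.continuous.comp_continuousOn (hc.add (hd.const_smul ε))
  have hcont' : ContinuousOn (fun q : ℝ × ℝ => fderiv ℝ P (c q.2 + q.1 • d q.2) (d q.2))
      (Icc (-1) 1 ×ˢ Icc a b) := by
    have hc2 : ContinuousOn (fun q : ℝ × ℝ => c q.2) (Icc (-1) 1 ×ˢ Icc a b) :=
      hc.comp continuousOn_snd (fun q hq => hq.2)
    have hd2 : ContinuousOn (fun q : ℝ × ℝ => d q.2) (Icc (-1) 1 ×ˢ Icc a b) :=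
      hd.comp continuousOn_snd (fun q hq => hq.2)
    exact (hPd.comp_continuousOn (hc2.add (continuousOn_fst.smul hd2))).clm_apply hd2
  obtain ⟨M, hM⟩ := (isCompact_Icc.prod isCompact_Icc).exists_bound_of_continuousOn hcont'
  have key := intervalIntegral.hasDerivAt_integral_of_dominated_loc_of_deriv_le
    (μ := volume) (a := a) (b := b) (x₀ := (0:ℝ)) (s := Icc (-1) 1)
    (F := fun ε x => P (c x + ε • d x))
    (F' := fun ε x => fderiv ℝ P (c x + ε • d x) (d x)) (bound := fun _ => M)
    (Icc_mem_nhds (by norm_num) (by norm_num))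
    (Filter.Eventually.of_forall fun ε => by
      rw [hU]
      exact ((hcont ε).mono Ioc_subset_Icc_self).aestronglyMeasurable measurableSet_Ioc)
    (by
      apply ContinuousOn.intervalIntegrable
      rw [uIcc_of_le hab.le]; exact hcont 0)
    (by
      rw [hU]
      refine ContinuousOn.aestronglyMeasurable ?_ measurableSet_Ioc
      refine ContinuousOn.mono ?_ Ioc_subset_Icc_self
      exact (hPd.comp_continuousOn (hc.add (hd.const_smul (0:ℝ)))).clm_apply hd)
    (by
      filter_upwards with t ht ε hε
      rw [hU] at ht
      exact hM (ε, t) ⟨hε, Ioc_subset_Icc_self ht⟩)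
    (by simp)
    (by
      filter_upwards with t ht ε hε
      have h1 : HasDerivAt (fun ε : ℝ => c t + ε • d t) (d t) ε := by
        simpa using ((hasDerivAt_id ε).smul_const (d t)).const_add (c t)
      exact ((hP.differentiable (by norm_num)) _).hasFDerivAt.comp_hasDerivAt ε h1)
  simpa using key.2

def Ker (T r : ℝ) : ℝ → ℝ := (Ioc 0 T).indicator (fun s => s ^ (-r))

lemma ker_int {T r : ℝ} (hT : 0 < T) (hr : r ∈ Ioo (0:ℝ) 1) : Integrable (Ker T r) := by
  unfold Ker
  rw [integrable_indicator_iff measurableSet_Ioc]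
  have := intervalIntegral.intervalIntegrable_rpow' (a := 0) (b := T) (r := -r) (by linarith [hr.2])
  exact (intervalIntegrable_iff_integrableOn_Ioc_of_le hT.le).1 this

lemma left_eq {a b r : ℝ} (hr : r ∈ Ioo (0:ℝ) 1) (u : ℝ → ℝ) {x : ℝ}
    (hx : x ∈ Icc a b) : (∫ t in a..x, (x - t) ^ (-r) * u t)
      = ∫ t, (Ioc a b).indicator u t * Ker (b - a) r (x - t) := by
  rw [intervalIntegral.integral_of_le hx.1, ← integral_indicator measurableSet_Ioc]
  congr 1
  ext t
  have hx1 := hx.1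
  have hx2 := hx.2
  unfold Ker
  by_cases h1 : t ∈ Ioc a x
  · have h2 : t ∈ Ioc a b := ⟨h1.1, h1.2.trans hx.2⟩
    rw [indicator_of_mem h1, indicator_of_mem h2]
    by_cases h3 : t = x
    · subst h3
      have : (-r) ≠ 0 := by linarith [hr.1]
      simp [Real.zero_rpow this]
    · have h4 : x - t ∈ Ioc 0 (b - a) := by
        constructor
        · have := lt_of_le_of_ne h1.2 h3
          linarith
        · linarith [h1.1]
      rw [indicator_of_mem h4]; ring
  · rw [indicator_of_notMem h1]
    by_cases h2 : t ∈ Ioc a b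
    · have h4 : x - t ∉ Ioc 0 (b - a) := fun h => h1 ⟨h2.1, by linarith [h.1]⟩
      rw [indicator_of_notMem h4]; simp
    · rw [indicator_of_notMem h2]; simp

lemma right_eq {a b r : ℝ} (u : ℝ → ℝ) {x : ℝ}
    (hx : x ∈ Icc a b) : (∫ t in x..b, (t - x) ^ (-r) * u t)
      = ∫ t, (Ioc a b).indicator u t * Ker (b - a) r (t - x) := by
  rw [intervalIntegral.integral_of_le hx.2, ← integral_indicator measurableSet_Ioc]
  congr 1
  ext t
  have hx1 := hx.1
  have hx2 := hx.2
  unfold Ker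
  by_cases h1 : t ∈ Ioc x b
  · have h2 : t ∈ Ioc a b := ⟨lt_of_le_of_lt hx.1 h1.1, h1.2⟩
    rw [indicator_of_mem h1, indicator_of_mem h2]
    have h4 : t - x ∈ Ioc 0 (b - a) := ⟨by linarith [h1.1], by linarith [h1.2]⟩
    rw [indicator_of_mem h4]; ring
  · rw [indicator_of_notMem h1]
    by_cases h2 : t ∈ Ioc a b
    · have h4 : t - x ∉ Ioc 0 (b - a) := fun h => h1 ⟨by linarith [h.1], h2.2⟩
      rw [indicator_of_notMem h4]; simp
    · rw [indicator_of_notMem h2]; simp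

lemma cont_left {a b r : ℝ} (hab : a < b) (hr : r ∈ Ioo (0:ℝ) 1) (u : ℝ → ℝ)
    (hu : Continuous u) (hs : ∀ t, t ∉ Ioc a b → u t = 0) :
    ContinuousOn (fun x => ∫ t in a..x, (x - t) ^ (-r) * u t) (Icc a b) := by
  have hK := ker_int (sub_pos.2 hab) hr
  obtain ⟨M, hM⟩ := (isCompact_Icc (a := a) (b := b)).exists_bound_of_continuousOn hu.continuousOn
  have hM' : ∀ t, ‖u t‖ ≤ |M| := by
    intro t
    by_cases ht : t ∈ Ioc a b
    · exact (hM t (Ioc_subset_Icc_self ht)).trans (le_abs_self M)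
    · rw [hs t ht]; simp
  have hind : (Ioc a b).indicator u = u := indicator_eq_self.2 fun t ht => by
    by_contra h; exact ht (hs t h)
  have h : Continuous (fun x => ∫ s, u (x - s) * Ker (b - a) r s) := by
    refine continuous_of_dominated (bound := fun s => |M| * ‖Ker (b - a) r s‖) ?_ ?_ ?_ ?_
    · intro x
      exact (by fun_prop : Continuous fun s => u (x - s)).aestronglyMeasurable.mul
        hK.aestronglyMeasurable
    · intro x
      filter_upwards with s
      rw [norm_mul]
      gcongr
      exact hM' _
    · exact hK.norm.const_mul _
    · filter_upwards with s
      fun_prop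
  refine h.continuousOn.congr fun x hx => ?_
  simp only
  rw [left_eq hr u hx, hind, ← integral_sub_left_eq_self _ volume x]
  simp

lemma cont_right {a b r : ℝ} (hab : a < b) (hr : r ∈ Ioo (0:ℝ) 1) (u : ℝ → ℝ)
    (hu : Continuous u) (hs : ∀ t, t ∉ Ioc a b → u t = 0) :
    ContinuousOn (fun x => ∫ t in x..b, (t - x) ^ (-r) * u t) (Icc a b) := by
  have hK := ker_int (sub_pos.2 hab) hr
  obtain ⟨M, hM⟩ := (isCompact_Icc (a := a) (b := b)).exists_bound_of_continuousOn hu.continuousOn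
  have hM' : ∀ t, ‖u t‖ ≤ |M| := by
    intro t
    by_cases ht : t ∈ Ioc a b
    · exact (hM t (Ioc_subset_Icc_self ht)).trans (le_abs_self M)
    · rw [hs t ht]; simp
  have hind : (Ioc a b).indicator u = u := indicator_eq_self.2 fun t ht => by
    by_contra h; exact ht (hs t h)
  have h : Continuous (fun x => ∫ s, u (s + x) * Ker (b - a) r s) := by
    refine continuous_of_dominated (bound := fun s => |M| * ‖Ker (b - a) r s‖) ?_ ?_ ?_ ?_
    · intro x
      exact (by fun_prop : Continuous fun s => u (s + x)).aestronglyMeasurable.mul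
        hK.aestronglyMeasurable
    · intro x
      filter_upwards with s
      rw [norm_mul]
      gcongr
      exact hM' _
    · exact hK.norm.const_mul _
    · filter_upwards with s
      fun_prop
  refine h.continuousOn.congr fun x hx => ?_
  simp only
  rw [right_eq u hx, hind, ← integral_add_right_eq_self _ x]
  simp

lemma fub {a b r : ℝ} (hab : a < b) (hr : r ∈ Ioo (0:ℝ) 1) (g u : ℝ → ℝ)
    (hg : ContinuousOn g (Icc a b)) (hu : ContinuousOn u (Icc a b)) :
    (∫ x in a..b, g x * ∫ t in a..x, (x - t) ^ (-r) * u t)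
      = ∫ t in a..b, u t * ∫ x in t..b, (x - t) ^ (-r) * g x := by
  have hK := ker_int (sub_pos.2 hab) hr
  set K := Ker (b - a) r with hKd
  set U := (Ioc a b).indicator u with hU
  set G := (Ioc a b).indicator g with hG
  have hUi : Integrable U := by
    rw [hU, integrable_indicator_iff measurableSet_Ioc]
    exact hu.integrableOn_Icc.mono_set Ioc_subset_Icc_self
  have hGi : Integrable G := by
    rw [hG, integrable_indicator_iff measurableSet_Ioc]
    exact hg.integrableOn_Icc.mono_set Ioc_subset_Icc_self
  obtain ⟨M, hM⟩ := (isCompact_Icc (a := a) (b := b)).exists_bound_of_continuousOn hg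
  have hM' : ∀ t, ‖G t‖ ≤ |M| := by
    intro t
    by_cases ht : t ∈ Ioc a b
    · rw [hG, indicator_of_mem ht]
      exact (hM t (Ioc_subset_Icc_self ht)).trans (le_abs_self M)
    · rw [hG, indicator_of_notMem ht]; simp
  have hI : Integrable (fun p : ℝ × ℝ => G p.1 * (U p.2 * K (p.1 - p.2)))
      (volume.prod volume) := by
    have h0 := Integrable.convolution_integrand (ContinuousLinearMap.mul ℝ ℝ) hUi hK
    refine Integrable.bdd_mul (c := |M|) h0 ?_ ?_
    · exact hGi.aestronglyMeasurable.comp_fst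
    · filter_upwards with p using hM' _
  have hsw := integral_integral_swap (f := fun x t => G x * (U t * K (x - t))) hI
  rw [intervalIntegral.integral_of_le hab.le, intervalIntegral.integral_of_le hab.le,
    ← integral_indicator measurableSet_Ioc, ← integral_indicator measurableSet_Ioc]
  calc _ = ∫ x, ∫ t, G x * (U t * K (x - t)) := by
        congr 1
        ext x
        rw [integral_const_mul]
        by_cases hx : x ∈ Ioc a b
        · rw [indicator_of_mem hx, hG, indicator_of_mem hx,
            left_eq hr u (Ioc_subset_Icc_self hx)]
        · rw [indicator_of_notMem hx, hG, indicator_of_notMem hx]; simp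
    _ = ∫ t, ∫ x, G x * (U t * K (x - t)) := hsw
    _ = _ := by
        congr 1
        ext t
        have : ∀ x, G x * (U t * K (x - t)) = U t * (G x * K (x - t)) := fun x => by ring
        simp_rw [this]
        rw [integral_const_mul]
        by_cases hx : t ∈ Ioc a b
        · rw [indicator_of_mem hx, hU, indicator_of_mem hx,
            right_eq g (Ioc_subset_Icc_self hx)]
        · rw [indicator_of_notMem hx, hU, indicator_of_notMem hx]; simp

lemma kl_int {a x r : ℝ} (hr : r ∈ Ioo (0:ℝ) 1) (hx : a ≤ x) (u : ℝ → ℝ)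
    (hu : ContinuousOn u (Icc a x)) :
    IntervalIntegrable (fun t => (x - t) ^ (-r) * u t) volume a x := by
  refine IntervalIntegrable.mul_continuousOn ?_ (by rwa [uIcc_of_le hx])
  have := (intervalIntegral.intervalIntegrable_rpow' (a := x - a) (b := 0) (r := -r)
    (by linarith [hr.2])).comp_sub_left x
  simpa using this

lemma kr_int {b x r : ℝ} (hr : r ∈ Ioo (0:ℝ) 1) (hx : x ≤ b) (u : ℝ → ℝ)
    (hu : ContinuousOn u (Icc x b)) :
    IntervalIntegrable (fun t => (t - x) ^ (-r) * u t) volume x b := by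
  refine IntervalIntegrable.mul_continuousOn ?_ (by rwa [uIcc_of_le hx])
  have := (intervalIntegral.intervalIntegrable_rpow' (a := 0) (b := b - x) (r := -r)
    (by linarith [hr.2])).comp_sub_right x
  simpa using this

lemma comb_add {a b α β γ : ℝ} (hα : α ∈ Ioo (0:ℝ) 1) (hβ : β ∈ Ioo (0:ℝ) 1)
    (f h : ℝ → ℝ) (hf : ContDiffOn1 a b f) (hh : ContDiffOn1 a b h) (e : ℝ)
    {x : ℝ} (hx : x ∈ Icc a b) :
    combCaputo a b α β γ (fun t => f t + e * h t) x
      = combCaputo a b α β γ f x + e * combCaputo a b α β γ h x := by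
  have hd : ∀ t ∈ Icc a b, deriv (fun t => f t + e * h t) t = deriv f t + e * deriv h t := by
    intro t ht
    exact ((hf.1 t ht).hasDerivAt.add ((hh.1 t ht).hasDerivAt.const_mul e)).deriv
  have s1 : Icc a x ⊆ Icc a b := Icc_subset_Icc_right hx.2
  have s2 : Icc x b ⊆ Icc a b := Icc_subset_Icc_left hx.1
  unfold combCaputo caputoL caputoR
  have e1 : (∫ t in a..x, (x - t) ^ (-α) * deriv (fun t => f t + e * h t) t)
      = (∫ t in a..x, (x - t) ^ (-α) * deriv f t) + e * ∫ t in a..x, (x - t) ^ (-α) * deriv h t := by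
    rw [← intervalIntegral.integral_const_mul, ← intervalIntegral.integral_add
      (kl_int hα hx.1 _ (hf.2.mono s1)) ((kl_int hα hx.1 _ (hh.2.mono s1)).const_mul e)]
    refine intervalIntegral.integral_congr fun t ht => ?_
    rw [uIcc_of_le hx.1] at ht
    simp only [hd t (s1 ht)]; ring
  have e2 : (∫ t in x..b, (t - x) ^ (-β) * deriv (fun t => f t + e * h t) t)
      = (∫ t in x..b, (t - x) ^ (-β) * deriv f t) + e * ∫ t in x..b, (t - x) ^ (-β) * deriv h t := by
    rw [← intervalIntegral.integral_const_mul, ← intervalIntegral.integral_add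
      (kr_int hβ hx.2 _ (hf.2.mono s2)) ((kr_int hβ hx.2 _ (hh.2.mono s2)).const_mul e)]
    refine intervalIntegral.integral_congr fun t ht => ?_
    rw [uIcc_of_le hx.2] at ht
    simp only [hd t (s2 ht)]; ring
  rw [e1, e2]; ring

lemma eta_facts {a b : ℝ} (η : ℝ → ℝ) (hη : ContDiff ℝ 1 η) (hs : tsupport η ⊆ Ioo a b) :
    Continuous (deriv η) ∧ (∀ t, t ∉ Ioc a b → deriv η t = 0) ∧ η a = 0 ∧ η b = 0 ∧
      ContDiffOn1 a b η := by
  have hc : Continuous (deriv η) := hη.continuous_deriv (by norm_num)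
  refine ⟨hc, ?_, ?_, ?_, ?_, hc.continuousOn⟩
  · intro t ht
    by_contra h
    exact ht (Ioo_subset_Ioc_self (hs (support_deriv_subset h)))
  · exact image_eq_zero_of_notMem_tsupport fun h => lt_irrefl _ (hs h).1
  · exact image_eq_zero_of_notMem_tsupport fun h => lt_irrefl _ (hs h).2
  · intro x _
    exact hη.differentiable (by norm_num) x

lemma comb_cont {a b α β γ : ℝ} (hab : a < b) (hα : α ∈ Ioo (0:ℝ) 1) (hβ : β ∈ Ioo (0:ℝ) 1)
    (η : ℝ → ℝ) (hη : ContDiff ℝ 1 η) (hs : tsupport η ⊆ Ioo a b) :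
    ContinuousOn (combCaputo a b α β γ η) (Icc a b) := by
  obtain ⟨h1, h2, -⟩ := eta_facts η hη hs
  exact (((cont_left hab hα _ h1 h2).const_mul (1 / Real.Gamma (1 - α))).const_mul γ).add
    (((cont_right hab hβ _ h1 h2).const_mul (-1 / Real.Gamma (1 - β))).const_mul (1 - γ))

lemma deriv_cont_of {a b c : ℝ} (hc : c ≠ 0) (f : ℝ → ℝ)
    (h : ContinuousOn (fun x => c * f x) (Icc a b)) : ContinuousOn f (Icc a b) := by
  refine (h.const_mul c⁻¹).congr fun x _ => ?_
  field_simp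

lemma ibp {a b : ℝ} (hab : a < b) (η G : ℝ → ℝ) (hη : ContDiff ℝ 1 η)
    (hs : tsupport η ⊆ Ioo a b) (hG : ∀ x ∈ Icc a b, DifferentiableAt ℝ G x)
    (hG' : ContinuousOn (deriv G) (Icc a b)) :
    (∫ x in a..b, deriv η x * G x) = - ∫ x in a..b, deriv G x * η x := by
  obtain ⟨h1, h2, h3, h4, h5⟩ := eta_facts η hη hs
  have := intervalIntegral.integral_mul_deriv_eq_deriv_mul (a := a) (b := b) (u := G) (v := η)
    (u' := deriv G) (v' := deriv η)
    (fun x hx => (hG x (by rwa [uIcc_of_le hab.le] at hx)).hasDerivAt)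
    (fun x hx => (h5.1 x (by rwa [uIcc_of_le hab.le] at hx)).hasDerivAt)
    (ContinuousOn.intervalIntegrable (by rwa [uIcc_of_le hab.le]))
    (h1.intervalIntegrable _ _)
  rw [h3, h4] at this
  simp only [mul_comm (deriv η _)]
  rw [this]; ring

lemma parts {a b α β γ : ℝ} (hab : a < b) (hα : α ∈ Ioo (0:ℝ) 1) (hβ : β ∈ Ioo (0:ℝ) 1)
    (g : ℝ → ℝ) (hg : ContinuousOn g (Icc a b))
    (hl : HasContLeftRLD a b β g) (hr : HasContRightRLD a b α g)
    (η : ℝ → ℝ) (hη : ContDiff ℝ 1 η) (hs : tsupport η ⊆ Ioo a b) :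
    (∫ x in a..b, g x * combCaputo a b α β γ η x)
      = ∫ x in a..b, combRLD a b β α γ g x * η x := by
  obtain ⟨h1, h2, h3, h4, h5⟩ := eta_facts η hη hs
  have hΓα : Real.Gamma (1 - α) ≠ 0 := (Real.Gamma_pos_of_pos (by linarith [hα.2])).ne'
  have hΓβ : Real.Gamma (1 - β) ≠ 0 := (Real.Gamma_pos_of_pos (by linarith [hβ.2])).ne'
  have hU : uIcc a b = Icc a b := uIcc_of_le hab.le
  have cL := cont_left hab hα _ h1 h2
  have cR := cont_right hab hβ _ h1 h2
  set F : ℝ → ℝ := fun s => ∫ t in a..s, (s - t) ^ (-β) * g t with hF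
  set G : ℝ → ℝ := fun s => ∫ t in s..b, (t - s) ^ (-α) * g t with hG
  have hF' : ContinuousOn (deriv F) (Icc a b) :=
    deriv_cont_of (c := 1 / Real.Gamma (1 - β)) (by positivity) _ hl.2
  have hG' : ContinuousOn (deriv G) (Icc a b) :=
    deriv_cont_of (c := -1 / Real.Gamma (1 - α)) (by
      rw [neg_div]; exact neg_ne_zero.2 (by positivity)) _ hr.2
  have i1 := fub hab hα g (deriv η) hg h1.continuousOn
  have i2 := fub hab hβ (deriv η) g h1.continuousOn hg
  have j1 := ibp hab η G hη hs hr.1 hG'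
  have j2 := ibp hab η F hη hs hl.1 hF'
  have k1 : IntervalIntegrable (fun x => g x * ∫ t in a..x, (x - t) ^ (-α) * deriv η t) volume a b :=
    ContinuousOn.intervalIntegrable (by rw [hU]; exact hg.mul cL)
  have k2 : IntervalIntegrable (fun x => g x * ∫ t in x..b, (t - x) ^ (-β) * deriv η t) volume a b :=
    ContinuousOn.intervalIntegrable (by rw [hU]; exact hg.mul cR)
  have k3 : IntervalIntegrable (fun x => deriv F x * η x) volume a b :=
    ContinuousOn.intervalIntegrable (by rw [hU]; exact hF'.mul hη.continuous.continuousOn)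
  have k4 : IntervalIntegrable (fun x => deriv G x * η x) volume a b :=
    ContinuousOn.intervalIntegrable (by rw [hU]; exact hG'.mul hη.continuous.continuousOn)
  calc _ = ∫ x in a..b, (γ * (1 / Real.Gamma (1 - α))) *
            (g x * ∫ t in a..x, (x - t) ^ (-α) * deriv η t)
          + ((1 - γ) * (-1 / Real.Gamma (1 - β))) *
            (g x * ∫ t in x..b, (t - x) ^ (-β) * deriv η t) := by
        congr 1; ext x; unfold combCaputo caputoL caputoR; ring
    _ = (γ * (1 / Real.Gamma (1 - α))) * (-∫ x in a..b, deriv G x * η x)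
          + ((1 - γ) * (-1 / Real.Gamma (1 - β))) * (-∫ x in a..b, deriv F x * η x) := by
        rw [intervalIntegral.integral_add (k1.const_mul _) (k2.const_mul _),
          intervalIntegral.integral_const_mul, intervalIntegral.integral_const_mul,
          i1, ← i2, j1, j2]
    _ = ∫ x in a..b, ((1 - γ) * (1 / Real.Gamma (1 - β))) * (deriv F x * η x)
          + (γ * (-1 / Real.Gamma (1 - α))) * (deriv G x * η x) := by
        rw [intervalIntegral.integral_add (k3.const_mul _) (k4.const_mul _),
          intervalIntegral.integral_const_mul, intervalIntegral.integral_const_mul]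
        ring
    _ = _ := by
        congr 1; ext x; unfold combRLD leftRLD rightRLD; ring

lemma pY_eq {N : ℕ} (L : ℝ → (Fin N → ℝ) → (Fin N → ℝ) → ℝ)
    (hL : ContDiff ℝ 1 fun p : ℝ × (Fin N → ℝ) × (Fin N → ℝ) => L p.1 p.2.1 p.2.2)
    (x : ℝ) (u w : Fin N → ℝ) (i : Fin N) :
    pY₂ L x u w i = fderiv ℝ (fun p : ℝ × (Fin N → ℝ) × (Fin N → ℝ) => L p.1 p.2.1 p.2.2)
      (x, u, w) (0, Pi.single i 1, 0) := by
  unfold pY₂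
  have h2 := (hL.differentiable (by norm_num) (x, Function.update u i (u i), w)).hasFDerivAt
  have h3 : HasDerivAt (fun s => (x, Function.update u i s, w))
      ((0, Pi.single i 1, 0) : ℝ × (Fin N → ℝ) × (Fin N → ℝ)) (u i) :=
    (hasDerivAt_const _ _).prodMk ((hasDerivAt_update u i (u i)).prodMk (hasDerivAt_const _ _))
  have h4 := (h2.comp_hasDerivAt (u i) h3).deriv
  rw [Function.update_eq_self] at h4
  exact h4

lemma pW_eq {N : ℕ} (L : ℝ → (Fin N → ℝ) → (Fin N → ℝ) → ℝ)
    (hL : ContDiff ℝ 1 fun p : ℝ × (Fin N → ℝ) × (Fin N → ℝ) => L p.1 p.2.1 p.2.2)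
    (x : ℝ) (u w : Fin N → ℝ) (i : Fin N) :
    pW₂ L x u w i = fderiv ℝ (fun p : ℝ × (Fin N → ℝ) × (Fin N → ℝ) => L p.1 p.2.1 p.2.2)
      (x, u, w) (0, 0, Pi.single i 1) := by
  unfold pW₂
  have h2 := (hL.differentiable (by norm_num) (x, u, Function.update w i (w i))).hasFDerivAt
  have h3 : HasDerivAt (fun s => (x, u, Function.update w i s))
      ((0, 0, Pi.single i 1) : ℝ × (Fin N → ℝ) × (Fin N → ℝ)) (w i) :=
    (hasDerivAt_const _ _).prodMk ((hasDerivAt_const _ _).prodMk (hasDerivAt_update w i (w i)))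
  have h4 := (h2.comp_hasDerivAt (w i) h3).deriv
  rw [Function.update_eq_self] at h4
  exact h4

lemma sup_bd {a b : ℝ} {N : ℕ} (hab : a < b) (e : Fin N → ℝ) (F : ℝ → Fin N → ℝ) (f : ℝ → ℝ)
    (ε M : ℝ) (hF : ∀ x ∈ Icc a b, F x = (ε * f x) • e) (hM : ∀ x ∈ Icc a b, ‖f x‖ ≤ M) :
    sSup ((fun x => ‖F x‖) '' Icc a b) ≤ |ε| * (M * ‖e‖) := by
  refine csSup_le ((nonempty_Icc.2 hab.le).image _) ?_
  rintro _ ⟨x, hx, rfl⟩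
  simp only
  rw [hF x hx, norm_smul, norm_mul, mul_assoc, Real.norm_eq_abs ε]
  have := hM x hx
  gcongr

lemma first_var
    (a b α β γ : ℝ) (N : ℕ) (hab : a < b)
    (hα : α ∈ Ioo (0:ℝ) 1) (hβ : β ∈ Ioo (0:ℝ) 1)
    (L : ℝ → (Fin N → ℝ) → (Fin N → ℝ) → ℝ)
    (hL : ContDiff ℝ 1 fun p : ℝ × (Fin N → ℝ) × (Fin N → ℝ) => L p.1 p.2.1 p.2.2)
    (y : ℝ → Fin N → ℝ) (hy : MemD a b α β γ y)
    (hmin : ∃ δ > (0:ℝ), ∀ z : ℝ → Fin N → ℝ, MemD a b α β γ z → z a = y a → z b = y b →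
      norm1inf a b α β γ (z - y) < δ →
        (∫ x in a..b, L x (y x) (combCaputoVec a b α β γ y x))
          ≤ ∫ x in a..b, L x (z x) (combCaputoVec a b α β γ z x))
    (i : Fin N) (η : ℝ → ℝ) (hη : ContDiff ℝ 1 η) (hs : tsupport η ⊆ Ioo a b) :
    (∫ x in a..b, (pY₂Along a b α β γ L y i x * η x
      + pW₂Along a b α β γ L y i x * combCaputo a b α β γ η x)) = 0 := by
  obtain ⟨h1, h2, h3, h4, h5⟩ := eta_facts η hη hs
  obtain ⟨δ, hδ, hmin⟩ := hmin
  obtain ⟨hy1, hy2, hy3⟩ := hy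
  have hC := comb_cont (γ := γ) hab hα hβ η hη hs
  set e : Fin N → ℝ := Pi.single i 1 with he
  have hycont : ContinuousOn y (Icc a b) := fun x hx => (hy1 x hx).continuousAt.continuousWithinAt
  have hyj : ∀ j, ContDiffOn1 a b (fun t => y t j) := by
    intro j
    refine ⟨fun x hx => differentiableAt_pi.1 (hy1 x hx) j, ?_⟩
    refine ((continuousOn_pi.1 hy2) j).congr fun x hx => ?_
    exact ((hasDerivAt_pi.1 (hy1 x hx).hasDerivAt) j).deriv
  set P : ℝ × (Fin N → ℝ) × (Fin N → ℝ) → ℝ := fun p => L p.1 p.2.1 p.2.2 with hP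
  set c : ℝ → ℝ × (Fin N → ℝ) × (Fin N → ℝ) :=
    fun x => (x, y x, combCaputoVec a b α β γ y x) with hc
  set d : ℝ → ℝ × (Fin N → ℝ) × (Fin N → ℝ) :=
    fun x => (0, η x • e, combCaputo a b α β γ η x • e) with hd
  have hcc : ContinuousOn c (Icc a b) := continuousOn_id.prodMk (hycont.prodMk hy3)
  have hdc : ContinuousOn d (Icc a b) := continuousOn_const.prodMk
    ((hη.continuous.continuousOn.smul continuousOn_const).prodMk (hC.smul continuousOn_const))
  have key := aux_deriv hab P hL c d hcc hdc
  -- the variation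
  set z : ℝ → ℝ → Fin N → ℝ := fun ε t => y t + (ε * η t) • e with hz
  have hzd : ∀ ε, ∀ x ∈ Icc a b, HasDerivAt (z ε) (deriv y x + (ε * deriv η x) • e) x := by
    intro ε x hx
    exact (hy1 x hx).hasDerivAt.add (((h5.1 x hx).hasDerivAt.const_mul ε).smul_const e)
  have hzc : ∀ ε, ∀ x ∈ Icc a b, combCaputoVec a b α β γ (z ε) x
      = combCaputoVec a b α β γ y x + (ε * combCaputo a b α β γ η x) • e := by
    intro ε x hx
    ext j
    have := comb_add (γ := γ) hα hβ (fun t => y t j) η (hyj j) h5 (ε * e j) hx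
    simp only [combCaputoVec, Pi.add_apply, Pi.smul_apply, smul_eq_mul]
    have e2 : (fun t => z ε t j) = fun t => y t j + (ε * e j) * η t := by
      ext t; simp only [hz, Pi.add_apply, Pi.smul_apply, smul_eq_mul]; ring
    rw [e2, this]; ring
  have hzmem : ∀ ε, MemD a b α β γ (z ε) := by
    intro ε
    refine ⟨fun x hx => (hzd ε x hx).differentiableAt, ?_, ?_⟩
    · refine ContinuousOn.congr ?_ fun x hx => (hzd ε x hx).deriv
      exact hy2.add ((h1.continuousOn.const_mul ε).smul continuousOn_const)
    · refine ContinuousOn.congr ?_ fun x hx => hzc ε x hx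
      exact hy3.add ((hC.const_mul ε).smul continuousOn_const)
  have hsub : ∀ ε, z ε - y = fun t => (ε * η t) • e := by
    intro ε; ext t; simp [hz]
  have hsc : ∀ ε, ∀ x ∈ Icc a b, combCaputoVec a b α β γ (z ε - y) x
      = (ε * combCaputo a b α β γ η x) • e := by
    intro ε x hx
    rw [hsub]
    ext j
    have := comb_add (γ := γ) hα hβ (fun t => 0) η
      ⟨fun x _ => differentiableAt_const _, by simp [continuousOn_const]⟩ h5 (ε * e j) hx
    simp only [combCaputoVec, Pi.smul_apply, smul_eq_mul]
    have e2 : (fun t => ε * η t * e j) = fun t => 0 + (ε * e j) * η t := by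
      ext t; ring
    rw [e2, this]
    simp only [combCaputo, caputoL, caputoR, deriv_const', mul_zero,
      intervalIntegral.integral_zero]
    ring
  obtain ⟨M1, hM1⟩ := (isCompact_Icc (a := a) (b := b)).exists_bound_of_continuousOn
    hη.continuous.continuousOn
  obtain ⟨M2, hM2⟩ := (isCompact_Icc (a := a) (b := b)).exists_bound_of_continuousOn
    h1.continuousOn
  obtain ⟨M3, hM3⟩ := (isCompact_Icc (a := a) (b := b)).exists_bound_of_continuousOn hC
  have hnorm : ∀ ε, norm1inf a b α β γ (z ε - y)
      ≤ |ε| * (M1 * ‖e‖) + |ε| * (M2 * ‖e‖) + |ε| * (M3 * ‖e‖) := by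
    intro ε
    unfold norm1inf
    refine add_le_add (add_le_add ?_ ?_) ?_
    · exact sup_bd hab e _ η ε M1 (fun x _ => by rw [hsub]) hM1
    · refine sup_bd hab e _ (deriv η) ε M2 (fun x hx => ?_) hM2
      rw [hsub]
      exact (((h5.1 x hx).hasDerivAt.const_mul ε).smul_const e).deriv
    · exact sup_bd hab e _ _ ε M3 (hsc ε) hM3
  have hJ : ∀ ε, (∫ x in a..b, P (c x + ε • d x))
      = ∫ x in a..b, L x (z ε x) (combCaputoVec a b α β γ (z ε) x) := by
    intro ε
    refine intervalIntegral.integral_congr fun x hx => ?_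
    rw [uIcc_of_le hab.le] at hx
    have hq := hzc ε x hx
    simp only [hz] at hq
    simp only [hq, hP, hc, hd, hz, Prod.smul_mk, Prod.mk_add_mk, smul_zero, add_zero,
      smul_smul]
  have hloc : IsLocalMin (fun ε : ℝ => ∫ x in a..b, P (c x + ε • d x)) 0 := by
    have ht : Filter.Tendsto (fun ε : ℝ => |ε| * (M1 * ‖e‖) + |ε| * (M2 * ‖e‖) + |ε| * (M3 * ‖e‖))
        (nhds 0) (nhds 0) := by
      have : Continuous (fun ε : ℝ =>
        |ε| * (M1 * ‖e‖) + |ε| * (M2 * ‖e‖) + |ε| * (M3 * ‖e‖)) := by fun_prop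
      simpa using this.tendsto 0
    filter_upwards [ht.eventually_lt_const hδ] with ε hε
    rw [hJ ε]
    simp only [zero_smul, add_zero]
    exact hmin (z ε) (hzmem ε) (by simp [hz, h3]) (by simp [hz, h4]) ((hnorm ε).trans_lt hε)
  have h0 := hloc.hasDerivAt_eq_zero key
  rw [← h0]
  congr 1
  ext x
  have hdx : d x = η x • ((0, e, 0) : ℝ × (Fin N → ℝ) × (Fin N → ℝ))
      + combCaputo a b α β γ η x • ((0, 0, e) : ℝ × (Fin N → ℝ) × (Fin N → ℝ)) := by
    simp [hd]
  rw [hdx, map_add, map_smul, map_smul, pY₂Along, pW₂Along, pY_eq L hL, pW_eq L hL]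
  simp only [smul_eq_mul, hc, hP, he]
  ring


/-- Fractional Euler–Lagrange equations for the problem with Lagrangian
`L(x, y(x), ^CD^{α,β}_γ y(x))`:
`∂ᵢL + D^{β,α}_{1−γ}∂_{N+i}L = 0` along a local minimizer. -/
theorem euler_lagrange_pure_fractional
    (a b α β γ : ℝ) (N : ℕ) (hab : a < b)
    (hα : α ∈ Ioo (0:ℝ) 1) (hβ : β ∈ Ioo (0:ℝ) 1) (hγ : γ ∈ Icc (0:ℝ) 1)
    (L : ℝ → (Fin N → ℝ) → (Fin N → ℝ) → ℝ)
    (hL : ContDiff ℝ 1 fun p : ℝ × (Fin N → ℝ) × (Fin N → ℝ) => L p.1 p.2.1 p.2.2)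
    (ya yb : Fin N → ℝ) (y : ℝ → Fin N → ℝ)
    (hy : MemD a b α β γ y) (hya : y a = ya) (hyb : y b = yb)
    (hmin : ∃ δ > (0:ℝ), ∀ z : ℝ → Fin N → ℝ, MemD a b α β γ z → z a = ya → z b = yb →
      norm1inf a b α β γ (z - y) < δ →
        (∫ x in a..b, L x (y x) (combCaputoVec a b α β γ y x))
          ≤ ∫ x in a..b, L x (z x) (combCaputoVec a b α β γ z x))
    (hRL : ∀ i : Fin N, HasContLeftRLD a b β (pW₂Along a b α β γ L y i) ∧
      HasContRightRLD a b α (pW₂Along a b α β γ L y i)) :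
    ∀ i : Fin N, ∀ x ∈ Icc a b,
      pY₂Along a b α β γ L y i x + combRLD a b β α γ (pW₂Along a b α β γ L y i) x = 0 := by

  intro i
  subst hya hyb
  obtain ⟨hl, hr⟩ := hRL i
  have hycont : ContinuousOn y (Icc a b) :=
    fun x hx => (hy.1 x hx).continuousAt.continuousWithinAt
  have hcc : ContinuousOn (fun x => (x, y x, combCaputoVec a b α β γ y x)) (Icc a b) :=
    continuousOn_id.prodMk (hycont.prodMk hy.2.2)
  have hfd := (hL.continuous_fderiv (by norm_num)).comp_continuousOn hcc
  have hpY : ContinuousOn (pY₂Along a b α β γ L y i) (Icc a b) :=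
    (hfd.clm_apply continuousOn_const).congr fun x _ => pY_eq L hL _ _ _ i
  have hpW : ContinuousOn (pW₂Along a b α β γ L y i) (Icc a b) :=
    (hfd.clm_apply continuousOn_const).congr fun x _ => pW_eq L hL _ _ _ i
  have hRc : ContinuousOn (combRLD a b β α γ (pW₂Along a b α β γ L y i)) (Icc a b) :=
    (hl.2.const_mul (1 - γ)).add (hr.2.const_mul γ)
  set H : ℝ → ℝ := fun x => pY₂Along a b α β γ L y i x
    + combRLD a b β α γ (pW₂Along a b α β γ L y i) x with hH
  have hHc : ContinuousOn H (Icc a b) := hpY.add hRc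
  have hU : uIcc a b = Icc a b := uIcc_of_le hab.le
  have hae : ∀ᵐ x, x ∈ Ioo a b → H x = 0 := by
    refine isOpen_Ioo.ae_eq_zero_of_integral_contDiff_smul_eq_zero
      ((hHc.mono Ioo_subset_Icc_self).locallyIntegrableOn measurableSet_Ioo) ?_
    intro η hη _ hs
    have hη1 : ContDiff ℝ 1 η := hη.of_le (by exact_mod_cast le_top)
    have hC := comb_cont (γ := γ) hab hα hβ η hη1 hs
    have hηc : ContinuousOn η (Icc a b) := hη1.continuous.continuousOn
    have f1 := first_var a b α β γ N hab hα hβ L hL y hy hmin i η hη1 hs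
    rw [intervalIntegral.integral_add
      (ContinuousOn.intervalIntegrable (by rw [hU]; exact hpY.mul hηc))
      (ContinuousOn.intervalIntegrable (by rw [hU]; exact hpW.mul hC)),
      parts hab hα hβ _ hpW hl hr η hη1 hs, ← intervalIntegral.integral_add
      (ContinuousOn.intervalIntegrable (by rw [hU]; exact hpY.mul hηc))
      (ContinuousOn.intervalIntegrable (by rw [hU]; exact hRc.mul hηc)),
      intervalIntegral.integral_of_le hab.le, ← integral_indicator measurableSet_Ioc] at f1
    rw [← f1]
    congr 1
    ext x
    by_cases hx : x ∈ Ioc a b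
    · rw [indicator_of_mem hx]
      simp only [hH, smul_eq_mul]; ring
    · rw [indicator_of_notMem hx, image_eq_zero_of_notMem_tsupport
        (fun h => hx (Ioo_subset_Ioc_self (hs h))), zero_smul]
  have hae2 : H =ᵐ[volume.restrict (Icc a b)] fun _ => 0 := by
    rw [← Measure.restrict_congr_set (Ioo_ae_eq_Icc (a := a) (b := b))]
    exact (ae_restrict_iff' measurableSet_Ioo).2 hae
  have := Measure.eqOn_Icc_of_ae_eq volume hab.ne hae2 hHc continuousOn_const
  exact fun x hx => this hx

end
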